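/- Let s ≥ 22, let a_j, b_j ∈ ℤ (1 ≤ j ≤ s) with (a_j,b_j) ≠ (0,0) for all j, a₂ = b₁ = 0 and a₁b₂ ≠ 0, and suppose each of the forms Λ_j = a_jα + b_jβ (2 ≤ j ≤ 22) has multiplicity at most 7 in the list Λ₂, …, Λ₂₂. Fix δ ∈ (0,1). Then for each P ≥ 2 the limit 𝔍 = lim_{X→∞} 𝔍(X) exists, and there is a constant C (independent of P and X) with |𝔍 − 𝔍(X)| ≤ C·P^{s−8}·X^{−1} for all X ≥ 1. Moreover, if the system a_1x_1⁴ + ⋯ + a_sx_s⁴ = 0, b_1x_1⁴ + ⋯ + b_sx_s⁴ = 0 has a non-singular real solution θ ∈ (0,1)^s with θ₁ > δ (a solution at which some 2×2 minor a_i θ_i³ b_j θ_j³ − a_j θ_j³ b_i θ_i³ is nonzero), then there is c > 0 (independent of P) with 𝔍 ≥ c·P^{s−8}. -/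

import Mathlib

open scoped Real
open Filter MeasureTheory

noncomputable section

/-- `e(z) = exp(2πiz)`. -/
def e (z : ℝ) : ℂ := Complex.exp (2 * Real.pi * Complex.I * z)

/-- The set `𝒜(P,R)` of `R`-smooth positive integers not exceeding `P`. -/
def smoothA (P R : ℝ) : Finset ℕ :=
  (Finset.Icc 1 ⌊P⌋₊).filter (fun n => ∀ p ∈ n.primeFactors, (p : ℝ) ≤ R)

/-- The smooth Weyl sum `h(α; P, R)`. -/
def h (P R α : ℝ) : ℂ := ∑ x ∈ smoothA P R, e (α * (x : ℝ) ^ 4)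

/-- `Δ₇ = 0.849408`. -/
def Δ₇ : ℝ := 0.849408

/-- `Δ₁₀ = 0.213431`. -/
def Δ₁₀ : ℝ := 0.213431

/-- Two binary linear forms `a₁α + b₁β` and `a₂α + b₂β` are equivalent when one is a
nonzero rational multiple of the other. -/
def equivForm (a₁ b₁ a₂ b₂ : ℤ) : Prop :=
  ∃ lam : ℚ, lam ≠ 0 ∧ (a₁ : ℚ) = lam * a₂ ∧ (b₁ : ℚ) = lam * b₂

/-- `v(θ) = ∫₀^P e(θγ⁴) dγ`. -/
def v (P θ : ℝ) : ℂ := ∫ γ in (0:ℝ)..P, e (θ * γ ^ 4)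

/-- `w(θ) = ∫_{δP}^P e(θγ⁴) dγ`. -/
def w (δ P θ : ℝ) : ℂ := ∫ γ in (δ * P)..P, e (θ * γ ^ 4)

/-- The truncated singular integral
`𝔍(X) = ∬_{[−XP⁻⁴, XP⁻⁴]²} w(a₁ξ) ∏_{j=2}^s v(a_jξ + b_jζ) dξ dζ`. -/
def 𝔍X (s : ℕ) (a b : ℕ → ℤ) (δ P X : ℝ) : ℂ :=
  ∫ ξ in (-(X * P ^ (-(4:ℤ))))..(X * P ^ (-(4:ℤ))),
    ∫ ζ in (-(X * P ^ (-(4:ℤ))))..(X * P ^ (-(4:ℤ))),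
      w δ P ((a 1 : ℝ) * ξ) *
        ∏ j ∈ Finset.Icc 2 s, v P ((a j : ℝ) * ξ + (b j : ℝ) * ζ)

lemma e_add (x y : ℝ) : e (x + y) = e x * e y := by
  simp only [e, ← Complex.exp_add]
  push_cast
  ring_nf

lemma e_sum {ι : Type*} (t : Finset ι) (f : ι → ℝ) : e (∑ i ∈ t, f i) = ∏ i ∈ t, e (f i) := by
  simp only [e, ← Complex.exp_sum, Complex.ofReal_sum, Finset.mul_sum]

lemma norm_e (x : ℝ) : ‖e x‖ = 1 := by
  have : 2 * (Real.pi : ℂ) * Complex.I * x = ((2 * Real.pi * x : ℝ) : ℂ) * Complex.I := by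
    push_cast; ring
  rw [e, this, Complex.norm_exp_ofReal_mul_I]

lemma continuous_e : Continuous e := by
  unfold e
  fun_prop

lemma v_eq_w (P θ : ℝ) : v P θ = w 0 P θ := by simp [v, w]

lemma w_scale (δ P θ : ℝ) : w δ P θ = P * w δ 1 (θ * P ^ 4) := by
  have := intervalIntegral.smul_integral_comp_mul_right (a := δ) (b := 1)
    (fun γ : ℝ => e (θ * γ ^ 4)) P
  simp only [w, mul_one, one_mul] at this ⊢
  rw [← this, Complex.real_smul]
  congr 3
  ext γ
  ring_nf

lemma continuous_w (δ P : ℝ) : Continuous (w δ P) := by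
  unfold w
  refine intervalIntegral.continuous_parametric_intervalIntegral_of_continuous' ?_ _ _
  exact continuous_e.comp (by fun_prop)

lemma norm_w_le_sub {δ : ℝ} (hδ : δ ≤ 1) (θ : ℝ) : ‖w δ 1 θ‖ ≤ 1 - δ := by
  have := intervalIntegral.norm_integral_le_of_norm_le_const (a := δ) (b := 1) (C := 1)
    (f := fun γ : ℝ => e (θ * γ ^ 4)) (fun γ _ => (norm_e _).le)
  rw [one_mul, abs_of_nonneg (by linarith)] at this
  simpa [w] using this

lemma norm_v_one_le (θ : ℝ) : ‖v 1 θ‖ ≤ 1 := by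
  simpa [v_eq_w] using norm_w_le_sub zero_le_one θ

/-- The oscillatory integral `∫₁^N e(σγ⁴) dγ` with `|σ| = 1` is bounded, by integration by parts. -/
lemma norm_integral_e_quartic_le {σ N : ℝ} (hσ : |σ| = 1) (hN : 1 ≤ N) :
    ‖∫ γ in (1 : ℝ)..N, e (σ * γ ^ 4)‖ ≤ 1 := by
  have hσ0 : σ ≠ 0 := by rintro rfl; simp at hσ
  have hpos : ∀ x ∈ Set.uIcc 1 N, 0 < x := fun x hx => by
    rw [Set.uIcc_of_le hN] at hx; linarith [hx.1]
  set κ : ℂ := 8 * Real.pi * Complex.I * σ with hκ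
  have hκ0 : κ ≠ 0 := by
    simp [hκ, hσ0, Real.pi_ne_zero]
  have hκn : ‖κ‖ = 8 * Real.pi := by
    simp [hκ, hσ, abs_of_pos Real.pi_pos]
  have hderiv : ∀ x ∈ Set.uIcc 1 N, HasDerivAt (fun x : ℝ => e (σ * x ^ 4) / (κ * (x : ℂ) ^ 3))
      (e (σ * x ^ 4) - 3 * e (σ * x ^ 4) / (κ * (x : ℂ) ^ 4)) x := by
    intro x hx
    have hx0 : (x : ℂ) ≠ 0 := by exact_mod_cast (hpos x hx).ne'
    have h1 : HasDerivAt (fun x : ℝ => (x : ℂ)) 1 x := Complex.ofRealCLM.hasDerivAt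
    have h2 : HasDerivAt (fun x : ℝ => e (σ * x ^ 4))
        (e (σ * x ^ 4) * (κ * (x : ℂ) ^ 3)) x := by
      have := (((h1.pow 4).const_mul (σ : ℂ)).const_mul (2 * Real.pi * Complex.I : ℂ)).cexp
      convert this using 1
      · ext y; simp [e]
      · simp [e, hκ]; ring
    have h3 := h2.div ((h1.pow 3).const_mul κ) (by simp [hκ0, hx0])
    refine h3.congr_deriv ?_
    simp only [Pi.pow_apply]
    field_simp
    push_cast
    ring
  have hce : Continuous fun γ : ℝ => e (σ * γ ^ 4) := continuous_e.comp (by fun_prop)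
  have hcq : ContinuousOn (fun x : ℝ => 3 * e (σ * x ^ 4) / (κ * (x : ℂ) ^ 4)) (Set.uIcc 1 N) := by
    refine (continuousOn_const.mul hce.continuousOn).div (by fun_prop) fun x hx => ?_
    have hx0 : (x : ℂ) ≠ 0 := by exact_mod_cast (hpos x hx).ne'
    simp [hκ0, hx0]
  have hint := intervalIntegral.integral_eq_sub_of_hasDerivAt hderiv
    ((hce.intervalIntegrable _ _).sub hcq.intervalIntegrable)
  rw [intervalIntegral.integral_sub (hce.intervalIntegrable _ _) hcq.intervalIntegrable,
    sub_eq_iff_eq_add] at hint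
  have hbd : ‖∫ x in (1 : ℝ)..N, 3 * e (σ * x ^ 4) / (κ * (x : ℂ) ^ 4)‖
      ≤ ∫ x in (1 : ℝ)..N, (3 / (8 * Real.pi)) * x ^ (-4 : ℤ) := by
    refine intervalIntegral.norm_integral_le_of_norm_le hN (ae_of_all _ fun t ht => ?_) ?_
    · have : 0 < t := by linarith [ht.1]
      simp [norm_e, hκn, abs_of_pos this]
      apply le_of_eq
      field_simp
    · refine (ContinuousOn.const_mul ?_ _).intervalIntegrable
      exact continuousOn_id.zpow₀ _ fun x hx => Or.inl (hpos x hx).ne'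
  rw [intervalIntegral.integral_const_mul, integral_zpow
    (Or.inr ⟨by norm_num, fun h0 => (hpos 0 h0).ne' rfl⟩)] at hbd
  have hN3 : 0 ≤ N ^ (-4 + 1 : ℤ) := by positivity
  have hterm : ∀ x : ℝ, 1 ≤ x → ‖e (σ * x ^ 4) / (κ * (x : ℂ) ^ 3)‖ ≤ 1 / (8 * Real.pi) := by
    intro x hx
    have : 1 ≤ x ^ 3 := one_le_pow₀ hx
    simp only [norm_div, norm_e, norm_mul, hκn, norm_pow, Complex.norm_real, Real.norm_eq_abs,
      abs_of_pos (show 0 < x by linarith)]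
    have := Real.pi_pos
    exact one_div_le_one_div_of_le (by positivity) (le_mul_of_one_le_right (by positivity) ‹_›)
  have hpi : 1 / (8 * Real.pi) ≤ 1 / 24 := by
    have := Real.pi_gt_three
    gcongr; linarith
  have hone := hterm 1 le_rfl
  have hNt := hterm N hN
  rw [hint]
  refine (norm_add_le _ _).trans ?_
  refine (add_le_add (norm_sub_le _ _) hbd).trans ?_
  have : 3 / (8 * Real.pi) * ((N ^ (-4 + 1 : ℤ) - 1 ^ (-4 + 1 : ℤ)) / ((-4 : ℤ) + 1))
      ≤ 1 / (8 * Real.pi) := by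
    have hp : 0 < 1 / (8 * Real.pi) := by positivity
    have : 3 / (8 * Real.pi) * ((N ^ (-4 + 1 : ℤ) - 1 ^ (-4 + 1 : ℤ)) / (((-4 : ℤ) : ℝ) + 1))
      = 1 / (8 * Real.pi) * (1 - N ^ (-4 + 1 : ℤ)) := by
        push_cast; rw [one_zpow]; ring
    rw [this]
    exact mul_le_of_le_one_right hp.le (by linarith)
  linarith

lemma norm_v_le_two {σ N : ℝ} (hσ : |σ| = 1) (hN : 0 ≤ N) : ‖v N σ‖ ≤ 2 := by
  rcases le_total N 1 with h1 | h1
  · rw [v_eq_w, w_scale, norm_mul, ← v_eq_w, Complex.norm_real, Real.norm_of_nonneg hN]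
    nlinarith [norm_v_one_le (σ * N ^ 4), norm_nonneg (v 1 (σ * N ^ 4))]
  · have hc : Continuous fun γ : ℝ => e (σ * γ ^ 4) := continuous_e.comp (by fun_prop)
    have h2 := intervalIntegral.integral_add_adjacent_intervals
      (hc.intervalIntegrable (μ := volume) 0 1) (hc.intervalIntegrable 1 N)
    have h3 := norm_v_one_le σ
    rw [v] at h3 ⊢
    rw [← h2]
    linarith [norm_add_le (∫ γ in (0 : ℝ)..1, e (σ * γ ^ 4)) (∫ γ in (1 : ℝ)..N, e (σ * γ ^ 4)),
      norm_integral_e_quartic_le hσ h1]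

/-- The fourth-power form of the decay estimate `v(θ) ≪ (1 + |θ|)^{-1/4}` for `P = 1`. -/
lemma norm_v_one_pow_four_le (θ : ℝ) : ‖v 1 θ‖ ^ 4 ≤ 17 / (1 + |θ|) := by
  rw [le_div_iff₀ (by positivity)]
  have h1 : ‖v 1 θ‖ ^ 4 ≤ 1 := pow_le_one₀ (norm_nonneg _) (norm_v_one_le θ)
  have h2 : ‖v 1 θ‖ ^ 4 * |θ| ≤ 16 := by
    rcases eq_or_ne θ 0 with rfl | hθ
    · simp
    set N : ℝ := |θ| ^ (1 / 4 : ℝ) with hN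
    have hN4 : N ^ 4 = |θ| := by
      rw [hN, ← Real.rpow_natCast, ← Real.rpow_mul (abs_nonneg θ)]
      norm_num
    have hN0 : 0 ≤ N := by positivity
    have hs : |(SignType.sign θ : ℝ)| = 1 := by
      rcases hθ.lt_or_gt with h | h <;> simp [h]
    have h3 := norm_v_le_two hs hN0
    rw [v_eq_w, w_scale, hN4, sign_mul_abs, ← v_eq_w, norm_mul, Complex.norm_real,
      Real.norm_of_nonneg hN0] at h3
    calc ‖v 1 θ‖ ^ 4 * |θ| = (N * ‖v 1 θ‖) ^ 4 := by rw [← hN4]; ring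
      _ ≤ 2 ^ 4 := by gcongr
      _ = 16 := by norm_num
  linarith

lemma equivForm_of_mul_eq_mul {a₁ b₁ a₂ b₂ : ℤ} (h₁ : (a₁, b₁) ≠ (0, 0))
    (h₂ : (a₂, b₂) ≠ (0, 0)) (hdet : a₁ * b₂ = a₂ * b₁) : equivForm a₁ b₁ a₂ b₂ := by
  have hq : (a₁ : ℚ) * b₂ = a₂ * b₁ := by exact_mod_cast hdet
  by_cases ha : a₂ = 0
  · subst ha
    have hb : b₂ ≠ 0 := by rintro rfl; exact h₂ rfl
    have ha₁ : a₁ = 0 := by simpa [hb] using hdet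
    have hb₁ : b₁ ≠ 0 := by rintro rfl; exact h₁ (by rw [ha₁])
    have hb' : (b₂ : ℚ) ≠ 0 := by exact_mod_cast hb
    have hb₁' : (b₁ : ℚ) ≠ 0 := by exact_mod_cast hb₁
    exact ⟨b₁ / b₂, div_ne_zero hb₁' hb', by simp [ha₁], by field_simp⟩
  · have ha' : (a₂ : ℚ) ≠ 0 := by exact_mod_cast ha
    have ha₁ : (a₁ : ℚ) ≠ 0 := by
      intro h0
      rw [h0, zero_mul, eq_comm, mul_eq_zero, or_iff_right ha'] at hq
      exact h₁ (by rw [Prod.mk.injEq]; exact ⟨by exact_mod_cast h0, by exact_mod_cast hq⟩)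
    refine ⟨a₁ / a₂, div_ne_zero ha₁ ha', by field_simp, ?_⟩
    field_simp
    linarith

/-- Two linearly independent integral forms with coefficients bounded by `M` cannot both be small. -/
lemma norm_le_of_not_equivForm {a₁ b₁ a₂ b₂ : ℤ} (h₁ : (a₁, b₁) ≠ (0, 0))
    (h₂ : (a₂, b₂) ≠ (0, 0)) (hne : ¬ equivForm a₁ b₁ a₂ b₂) {M m : ℝ} (ha₁ : |(a₁ : ℝ)| ≤ M)
    (hb₁ : |(b₁ : ℝ)| ≤ M) (ha₂ : |(a₂ : ℝ)| ≤ M) (hb₂ : |(b₂ : ℝ)| ≤ M) (p : ℝ × ℝ)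
    (hm₁ : |a₁ * p.1 + b₁ * p.2| ≤ m) (hm₂ : |a₂ * p.1 + b₂ * p.2| ≤ m) :
    ‖p‖ ≤ 2 * M * m := by
  have hdet : a₁ * b₂ - a₂ * b₁ ≠ 0 := fun h0 =>
    hne (equivForm_of_mul_eq_mul h₁ h₂ (sub_eq_zero.mp h0))
  have hdet1 : 1 ≤ |(a₁ : ℝ) * b₂ - a₂ * b₁| := by exact_mod_cast Int.one_le_abs hdet
  have hM : 0 ≤ M := (abs_nonneg _).trans ha₁
  have key : ∀ x c₁ c₂ : ℝ, |c₁| ≤ M → |c₂| ≤ M →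
      (a₁ * b₂ - a₂ * b₁) * x = c₁ * (a₁ * p.1 + b₁ * p.2) + c₂ * (a₂ * p.1 + b₂ * p.2) →
      |x| ≤ 2 * M * m := by
    intro x c₁ c₂ hc₁ hc₂ hx
    calc |x| ≤ |(a₁ : ℝ) * b₂ - a₂ * b₁| * |x| := le_mul_of_one_le_left (abs_nonneg _) hdet1
      _ = |c₁ * (a₁ * p.1 + b₁ * p.2) + c₂ * (a₂ * p.1 + b₂ * p.2)| := by rw [← abs_mul, hx]
      _ ≤ |c₁| * |a₁ * p.1 + b₁ * p.2| + |c₂| * |a₂ * p.1 + b₂ * p.2| := by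
          rw [← abs_mul, ← abs_mul]; exact abs_add_le _ _
      _ ≤ M * m + M * m := by gcongr
      _ = 2 * M * m := by ring
  rw [Prod.norm_def, max_le_iff]
  exact ⟨key p.1 b₂ (-b₁) hb₂ (by rwa [abs_neg]) (by ring),
    key p.2 (-a₂) a₁ (by rwa [abs_neg]) ha₁ (by ring)⟩

/-- The integrand of the singular integral at `P = 1`. -/
def singularIntegrand (s : ℕ) (a b : ℕ → ℤ) (δ : ℝ) (p : ℝ × ℝ) : ℂ :=
  w δ 1 ((a 1 : ℝ) * p.1) * ∏ j ∈ Finset.Icc 2 s, v 1 ((a j : ℝ) * p.1 + (b j : ℝ) * p.2)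

lemma continuous_singularIntegrand (s : ℕ) (a b : ℕ → ℤ) (δ : ℝ) :
    Continuous (singularIntegrand s a b δ) := by
  unfold singularIntegrand
  simp only [v_eq_w]
  refine ((continuous_w δ 1).comp (by fun_prop)).mul (continuous_finsetProd _ fun j _ => ?_)
  exact (continuous_w 0 1).comp (by fun_prop)

open scoped Classical in
lemma exists_norm_singularIntegrand_le {s : ℕ} (hs : 22 ≤ s) {a b : ℕ → ℤ} {δ : ℝ}
    (hδ0 : 0 ≤ δ) (hδ1 : δ ≤ 1) (hnz : ∀ j ∈ Finset.Icc 2 22, (a j, b j) ≠ (0, 0))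
    (hmult : ∀ j ∈ Finset.Icc 2 22, ((Finset.Icc 2 22).filter
        (fun i => equivForm (a i) (b i) (a j) (b j))).card ≤ 7) :
    ∃ C : ℝ, 0 ≤ C ∧
      ∀ p, ‖singularIntegrand s a b δ p‖ ≤ C * (1 + ‖p‖) ^ (-(7 / 2) : ℝ) := by
  set M : ℝ := 1 + ∑ j ∈ Finset.Icc 2 22, (|(a j : ℝ)| + |(b j : ℝ)|) with hMdef
  have hsum : ∀ j ∈ Finset.Icc 2 22, |(a j : ℝ)| + |(b j : ℝ)| ≤ M := fun j hj => by
    have := Finset.single_le_sum (f := fun j => |(a j : ℝ)| + |(b j : ℝ)|)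
      (fun i _ => by positivity) hj
    linarith
  have haM : ∀ j ∈ Finset.Icc 2 22, |(a j : ℝ)| ≤ M := fun j hj => by
    linarith [hsum j hj, abs_nonneg (b j : ℝ)]
  have hbM : ∀ j ∈ Finset.Icc 2 22, |(b j : ℝ)| ≤ M := fun j hj => by
    linarith [hsum j hj, abs_nonneg (a j : ℝ)]
  have hM1 : 1 ≤ M := by
    have : 0 ≤ ∑ j ∈ Finset.Icc 2 22, (|(a j : ℝ)| + |(b j : ℝ)|) :=
      Finset.sum_nonneg fun i _ => by positivity
    linarith
  set K : ℝ := 17 * (2 * M) with hK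
  have hK0 : 0 ≤ K := by positivity
  refine ⟨K ^ (7 / 2 : ℝ), by positivity, fun p => ?_⟩
  set form : ℕ → ℝ := fun j => (a j : ℝ) * p.1 + (b j : ℝ) * p.2 with hform
  set small := (Finset.Icc 2 22).filter (fun j => ¬ ‖p‖ ≤ 2 * M * |form j|) with hsmall
  have hsmall7 : small.card ≤ 7 := by
    rcases small.eq_empty_or_nonempty with h0 | ⟨j₀, hj₀⟩
    · simp [h0]
    rw [hsmall, Finset.mem_filter] at hj₀
    refine (Finset.card_le_card fun i hi => ?_).trans (hmult j₀ hj₀.1)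
    rw [hsmall, Finset.mem_filter] at hi
    rw [Finset.mem_filter]
    refine ⟨hi.1, ?_⟩
    by_contra hne
    have := norm_le_of_not_equivForm (hnz i hi.1) (hnz j₀ hj₀.1) hne (haM i hi.1) (hbM i hi.1)
      (haM j₀ hj₀.1) (hbM j₀ hj₀.1) p (le_max_left _ _) (le_max_right _ _)
    rcases max_choice |form i| |form j₀| with h | h
    · exact hi.2 (h ▸ this)
    · exact hj₀.2 (h ▸ this)
  have hbig : 14 ≤ ((Finset.Icc 2 22).filter (fun j => ‖p‖ ≤ 2 * M * |form j|)).card := by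
    have : ((Finset.Icc 2 22).filter (fun j => ‖p‖ ≤ 2 * M * |form j|)).card + small.card
        = (Finset.Icc 2 22).card := Finset.card_filter_add_card_filter_not _
    rw [Nat.card_Icc] at this
    omega
  obtain ⟨t, ht, htcard⟩ := Finset.exists_subset_card_eq hbig
  have hts : t ⊆ Finset.Icc 2 s := fun j hj => by
    have := (Finset.mem_filter.mp (ht hj)).1
    rw [Finset.mem_Icc] at this ⊢
    omega
  have hw : ‖w δ 1 ((a 1 : ℝ) * p.1)‖ ≤ 1 := (norm_w_le_sub hδ1 _).trans (by linarith)
  have hV : ‖singularIntegrand s a b δ p‖ ≤ ∏ j ∈ t, ‖v 1 (form j)‖ := by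
    rw [singularIntegrand, norm_mul, norm_prod, ← Finset.prod_sdiff hts]
    refine (mul_le_of_le_one_left (by positivity) hw).trans (mul_le_of_le_one_left
      (by positivity) (Finset.prod_le_one (fun _ _ => norm_nonneg _) fun j _ => norm_v_one_le _))
  have h1p : 0 < 1 + ‖p‖ := by positivity
  have hpow : ‖singularIntegrand s a b δ p‖ ^ 4 ≤ (K / (1 + ‖p‖)) ^ 14 := by
    calc ‖singularIntegrand s a b δ p‖ ^ 4 ≤ (∏ j ∈ t, ‖v 1 (form j)‖) ^ 4 := by gcongr
      _ = ∏ j ∈ t, ‖v 1 (form j)‖ ^ 4 := (Finset.prod_pow _ _ _).symm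
      _ ≤ ∏ j ∈ t, K / (1 + ‖p‖) := by
        refine Finset.prod_le_prod (fun _ _ => by positivity) fun j hj => ?_
        have := (Finset.mem_filter.mp (ht hj)).2
        refine (norm_v_one_pow_four_le _).trans ?_
        rw [div_le_div_iff₀ (by positivity) h1p]
        nlinarith [abs_nonneg (form j)]
      _ = (K / (1 + ‖p‖)) ^ 14 := by rw [Finset.prod_const, htcard]
  have hfinal : ‖singularIntegrand s a b δ p‖ ≤ (K / (1 + ‖p‖)) ^ (7 / 2 : ℝ) := by
    refine (pow_le_pow_iff_left₀ (norm_nonneg _) (by positivity) (n := 4) (by norm_num)).mp ?_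
    refine hpow.trans_eq ?_
    rw [← Real.rpow_natCast (_ ^ _), ← Real.rpow_mul (by positivity), ← Real.rpow_natCast]
    norm_num
  rwa [Real.div_rpow hK0 h1p.le, div_eq_mul_inv, ← Real.rpow_neg h1p.le] at hfinal

lemma integrable_one_add_norm_plane {r : ℝ} (hr : 2 < r) :
    Integrable fun p : ℝ × ℝ => (1 + ‖p‖) ^ (-r) := by
  refine integrable_one_add_norm ?_
  simpa using hr

lemma integrable_of_norm_le_one_add_norm {F : ℝ × ℝ → ℂ} (hF : Continuous F) {C : ℝ}
    (hC : ∀ p, ‖F p‖ ≤ C * (1 + ‖p‖) ^ (-(7 / 2) : ℝ)) : Integrable F :=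
  ((integrable_one_add_norm_plane (by norm_num)).const_mul C).mono' hF.aestronglyMeasurable
    (ae_of_all _ hC)

lemma exists_norm_integral_sub_setIntegral_square_le {F : ℝ × ℝ → ℂ} (hF : Continuous F) {C : ℝ}
    (hC0 : 0 ≤ C) (hC : ∀ p, ‖F p‖ ≤ C * (1 + ‖p‖) ^ (-(7 / 2) : ℝ)) :
    ∃ D : ℝ, ∀ X : ℝ, 0 < X →
      ‖(∫ p, F p) - ∫ p in Set.Ioc (-X) X ×ˢ Set.Ioc (-X) X, F p‖ ≤ D / X := by
  have hint := integrable_of_norm_le_one_add_norm hF hC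
  have hg := integrable_one_add_norm_plane (r := 5 / 2) (by norm_num)
  refine ⟨C * ∫ p : ℝ × ℝ, (1 + ‖p‖) ^ (-(5 / 2) : ℝ), fun X hX => ?_⟩
  have hS : MeasurableSet (Set.Ioc (-X) X ×ˢ Set.Ioc (-X) X) :=
    measurableSet_Ioc.prod measurableSet_Ioc
  rw [← integral_add_compl hS hint, add_sub_cancel_left]
  have hbound : ∀ p ∈ (Set.Ioc (-X) X ×ˢ Set.Ioc (-X) X)ᶜ,
      ‖F p‖ ≤ C / X * (1 + ‖p‖) ^ (-(5 / 2) : ℝ) := by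
    intro p hp
    have hXp : X ≤ ‖p‖ := by
      by_contra! hlt
      rw [Prod.norm_def, max_lt_iff, Real.norm_eq_abs, Real.norm_eq_abs, abs_lt, abs_lt] at hlt
      exact hp ⟨⟨hlt.1.1, hlt.1.2.le⟩, ⟨hlt.2.1, hlt.2.2.le⟩⟩
    have h1p : 0 < 1 + ‖p‖ := by positivity
    calc ‖F p‖ ≤ C * (1 + ‖p‖) ^ (-(7 / 2) : ℝ) := hC p
      _ = C * ((1 + ‖p‖)⁻¹ * (1 + ‖p‖) ^ (-(5 / 2) : ℝ)) := by
        rw [← Real.rpow_neg_one, ← Real.rpow_add h1p]; norm_num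
      _ ≤ C * (X⁻¹ * (1 + ‖p‖) ^ (-(5 / 2) : ℝ)) := by gcongr; linarith
      _ = C / X * (1 + ‖p‖) ^ (-(5 / 2) : ℝ) := by ring
  refine (norm_integral_le_of_norm_le (hg.const_mul (C / X)).integrableOn
    (ae_restrict_of_forall_mem hS.compl hbound)).trans ?_
  refine (setIntegral_le_integral (hg.const_mul (C / X)) (ae_of_all _ fun p => ?_)).trans_eq ?_
  · have := hX.le
    simp only [Pi.zero_apply]
    positivity
  · rw [integral_const_mul]; ring

lemma 𝔍X_one_eq_setIntegral {s : ℕ} {a b : ℕ → ℤ} {δ : ℝ}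
    (hint : Integrable (singularIntegrand s a b δ)) {X : ℝ} (hX : 0 ≤ X) :
    𝔍X s a b δ 1 X = ∫ p in Set.Ioc (-X) X ×ˢ Set.Ioc (-X) X, singularIntegrand s a b δ p := by
  rw [Measure.volume_eq_prod, setIntegral_prod _ hint.integrableOn]
  simp only [𝔍X, one_zpow, mul_one, intervalIntegral.integral_of_le (show -X ≤ X by linarith),
    singularIntegrand]

lemma 𝔍X_scale {s : ℕ} (hs : 8 ≤ s) (a b : ℕ → ℤ) (δ : ℝ) {P : ℝ} (hP : 0 < P) (X : ℝ) :
    𝔍X s a b δ P X = (P : ℂ) ^ (s - 8) * 𝔍X s a b δ 1 X := by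
  have hPC : (P : ℂ) ≠ 0 := by exact_mod_cast hP.ne'
  have hcard : (Finset.Icc 2 s).card = s - 1 := by simp
  have hintegrand : ∀ ξ ζ : ℝ, w δ P ((a 1 : ℝ) * ξ) *
        ∏ j ∈ Finset.Icc 2 s, v P ((a j : ℝ) * ξ + (b j : ℝ) * ζ)
      = (P : ℂ) ^ s * singularIntegrand s a b δ (ξ * P ^ 4, ζ * P ^ 4) := by
    intro ξ ζ
    simp only [singularIntegrand, v_eq_w, w_scale _ P, Finset.prod_mul_distrib, Finset.prod_const,
      hcard]
    obtain ⟨n, rfl⟩ : ∃ n, s = n + 1 := ⟨s - 1, by omega⟩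
    simp only [add_mul, mul_assoc, Nat.add_sub_cancel, pow_succ']
    ring
  have hlim : X * P ^ (-(4 : ℤ)) * P ^ 4 = X := by
    rw [zpow_neg]; field_simp
  have hP4 : P ^ 4 ≠ 0 := by positivity
  have hsub : ∀ f : ℝ → ℂ, ∫ x in (-(X * P ^ (-(4 : ℤ))))..(X * P ^ (-(4 : ℤ))), f (x * P ^ 4)
      = ((P : ℂ) ^ 4)⁻¹ * ∫ x in (-X)..X, f x := by
    intro f
    rw [intervalIntegral.integral_comp_mul_right f hP4, neg_mul, hlim, Complex.real_smul]
    push_cast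
    rfl
  have hone : 𝔍X s a b δ 1 X
      = ∫ ξ in (-X)..X, ∫ ζ in (-X)..X, singularIntegrand s a b δ (ξ, ζ) := by
    simp [𝔍X, singularIntegrand]
  rw [hone, 𝔍X]
  simp only [hintegrand, intervalIntegral.integral_const_mul]
  simp only [fun ξ : ℝ => hsub fun ζ => singularIntegrand s a b δ (ξ * P ^ 4, ζ)]
  rw [hsub fun ξ => ((P : ℂ) ^ 4)⁻¹ * ∫ ζ in (-X)..X, singularIntegrand s a b δ (ξ, ζ),
    intervalIntegral.integral_const_mul]
  obtain ⟨n, rfl⟩ : ∃ n, s = n + 8 := ⟨s - 8, by omega⟩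
  rw [Nat.add_sub_cancel]
  field_simp
  ring

lemma integral_e_mul_gaussian {η : ℝ} (hη : 0 < η) (y : ℝ) :
    ∫ ξ : ℝ, e (ξ * y) * (Real.exp (-(π * η ^ 2) * ξ ^ 2) : ℂ)
      = ((η⁻¹ * Real.exp (-π * (y / η) ^ 2) : ℝ) : ℂ) := by
  have hπ := Real.pi_pos
  have hb : 0 < ((π * η ^ 2 : ℝ) : ℂ).re := by
    rw [Complex.ofReal_re]; positivity
  have := fourierIntegral_gaussian hb (2 * π * y)
  have hroot : ((π : ℂ) / ((π * η ^ 2 : ℝ) : ℂ)) ^ (1 / 2 : ℂ) = ((η⁻¹ : ℝ) : ℂ) := by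
    have : (π : ℂ) / ((π * η ^ 2 : ℝ) : ℂ) = ((η⁻¹ ^ 2 : ℝ) : ℂ) := by
      rw [← Complex.ofReal_div]
      congr 1
      field_simp
    rw [this, show (1 / 2 : ℂ) = ((1 / 2 : ℝ) : ℂ) by push_cast; rfl,
      ← Complex.ofReal_cpow (by positivity), ← Real.sqrt_eq_rpow, Real.sqrt_sq (by positivity)]
  rw [hroot] at this
  have hηC : (η : ℂ) ≠ 0 := by exact_mod_cast hη.ne'
  have hπC : (π : ℂ) ≠ 0 := by exact_mod_cast hπ.ne'
  convert this using 1
  · congr 1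
    ext ξ
    simp only [e]
    push_cast
    ring_nf
  · push_cast
    congr 2
    field_simp
    ring

/-- The Gaussian-smoothed density at `y = -cγ⁴` of the values of `cγ⁴` for `γ ∈ [δ, 1]`. -/
def quarticDensity (δ c η y : ℝ) : ℝ :=
  ∫ γ in δ..1, η⁻¹ * Real.exp (-π * ((c * γ ^ 4 + y) / η) ^ 2)

lemma continuous_quarticDensity (δ c η : ℝ) : Continuous (quarticDensity δ c η) := by
  unfold quarticDensity
  refine intervalIntegral.continuous_parametric_intervalIntegral_of_continuous' ?_ _ _
  simp only [div_eq_mul_inv]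
  fun_prop

lemma quarticDensity_nonneg {δ c η : ℝ} (hδ : δ ≤ 1) (hη : 0 < η) (y : ℝ) :
    0 ≤ quarticDensity δ c η y :=
  intervalIntegral.integral_nonneg hδ fun _ _ => by positivity

lemma quarticDensity_le {δ c η : ℝ} (hδ0 : 0 ≤ δ) (hδ : δ ≤ 1) (hη : 0 < η) (y : ℝ) :
    quarticDensity δ c η y ≤ η⁻¹ := by
  have h := intervalIntegral.norm_integral_le_of_norm_le_const (a := δ) (b := 1) (C := η⁻¹)
    (f := fun γ : ℝ => η⁻¹ * Real.exp (-π * ((c * γ ^ 4 + y) / η) ^ 2)) fun γ _ => by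
      rw [Real.norm_of_nonneg (by positivity)]
      refine mul_le_of_le_one_right (by positivity) (Real.exp_le_one_iff.mpr ?_)
      nlinarith [Real.pi_pos, sq_nonneg ((c * γ ^ 4 + y) / η)]
  rw [abs_of_nonneg (by linarith)] at h
  exact (le_abs_self _).trans (h.trans (mul_le_of_le_one_right (by positivity) (by linarith)))

lemma exists_le_quarticDensity {δ c θ : ℝ} (hc : c ≠ 0) (hδ : 0 ≤ δ) (hθ : δ < θ) (hθ1 : θ < 1) :
    ∃ U ∈ nhds (-(c * θ ^ 4)), ∃ κ : ℝ, 0 < κ ∧ ∃ η₀ : ℝ, 0 < η₀ ∧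
      ∀ y ∈ U, ∀ η : ℝ, 0 < η → η < η₀ → κ ≤ quarticDensity δ c η y := by
  set f : ℝ → ℝ := fun γ => -(c * γ ^ 4) with hf
  obtain ⟨α, hα, hαθ⟩ := exists_between hθ
  obtain ⟨β, hθβ, hβ⟩ := exists_between hθ1
  have hα4 : α ^ 4 < θ ^ 4 := by gcongr; linarith
  have hβ4 : θ ^ 4 < β ^ 4 := by gcongr; linarith
  have hU : Set.uIcc (f α) (f β) ∈ nhds (f θ) := by
    rcases hc.lt_or_gt with hc | hc
    · rw [Set.uIcc_of_le (by simp only [hf]; nlinarith)]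
      exact Icc_mem_nhds (by simp only [hf]; nlinarith) (by simp only [hf]; nlinarith)
    · rw [Set.uIcc_of_ge (by simp only [hf]; nlinarith)]
      exact Icc_mem_nhds (by simp only [hf]; nlinarith) (by simp only [hf]; nlinarith)
  refine ⟨_, hU, Real.exp (-π * (4 * c) ^ 2), Real.exp_pos _, 1 - β, by linarith, ?_⟩
  intro y hy η hη hηβ
  obtain ⟨τ, hτ, rfl⟩ := intermediate_value_uIcc (by fun_prop : ContinuousOn f _) hy
  rw [Set.uIcc_of_le (by linarith)] at hτ
  have hcont : Continuous fun γ : ℝ => η⁻¹ * Real.exp (-π * ((c * γ ^ 4 + f τ) / η) ^ 2) := by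
    simp only [div_eq_mul_inv]
    fun_prop
  calc Real.exp (-π * (4 * c) ^ 2)
      = ∫ γ in τ..(τ + η), η⁻¹ * Real.exp (-π * (4 * c) ^ 2) := by
        rw [intervalIntegral.integral_const, add_sub_cancel_left, smul_eq_mul,
          mul_inv_cancel_left₀ hη.ne']
    _ ≤ ∫ γ in τ..(τ + η), η⁻¹ * Real.exp (-π * ((c * γ ^ 4 + f τ) / η) ^ 2) := by
        refine intervalIntegral.integral_mono_on (by linarith) (by simp)
          (hcont.intervalIntegrable _ _) fun γ hγ => ?_
        have hγ1 : γ ≤ 1 := by linarith [hγ.2, hτ.2]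
        have hτ0 : 0 ≤ τ := by linarith [hτ.1]
        have hγ0 : 0 ≤ γ := hτ0.trans hγ.1
        have hτ1 : τ ≤ 1 := hγ.1.trans hγ1
        have h4 : |γ ^ 4 - τ ^ 4| ≤ 4 * η := by
          have hfac : γ ^ 4 - τ ^ 4 = (γ - τ) * (γ ^ 3 + γ ^ 2 * τ + γ * τ ^ 2 + τ ^ 3) := by ring
          rw [hfac, abs_of_nonneg (mul_nonneg (by linarith [hγ.1]) (by positivity)), mul_comm]
          have h1 : γ ^ 3 ≤ 1 := pow_le_one₀ hγ0 hγ1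
          have h2 : γ ^ 2 * τ ≤ 1 := mul_le_one₀ (pow_le_one₀ hγ0 hγ1) hτ0 hτ1
          have h3 : γ * τ ^ 2 ≤ 1 := mul_le_one₀ hγ1 (by positivity) (pow_le_one₀ hτ0 hτ1)
          have h5 : τ ^ 3 ≤ 1 := pow_le_one₀ hτ0 hτ1
          exact mul_le_mul (by linarith) (by linarith [hγ.2]) (by linarith [hγ.1]) (by norm_num)
        have hq : |(c * γ ^ 4 + f τ) / η| ≤ |4 * c| := by
          rw [abs_div, abs_of_pos hη, div_le_iff₀ hη,
            show c * γ ^ 4 + f τ = c * (γ ^ 4 - τ ^ 4) by simp only [hf]; ring, abs_mul, abs_mul,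
            abs_of_pos (by norm_num : (0 : ℝ) < 4)]
          nlinarith [abs_nonneg c]
        have := sq_le_sq.mpr hq
        gcongr η⁻¹ * Real.exp ?_
        nlinarith [Real.pi_pos]
    _ ≤ quarticDensity δ c η (f τ) :=
        intervalIntegral.integral_mono_interval (by linarith [hτ.1]) (by linarith)
          (by linarith [hτ.2]) (ae_of_all _ fun γ => by positivity) (hcont.intervalIntegrable _ _)

lemma integrable_gaussian {η : ℝ} (hη : 0 < η) :
    Integrable fun ξ : ℝ => Real.exp (-(π * η ^ 2) * ξ ^ 2) :=
  integrable_exp_neg_mul_sq (by positivity)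

lemma integral_w_mul_e_mul_gaussian {δ η : ℝ} (hδ : δ ≤ 1) (hη : 0 < η) (c y : ℝ) :
    ∫ ξ : ℝ, w δ 1 (c * ξ) * e (ξ * y) * (Real.exp (-(π * η ^ 2) * ξ ^ 2) : ℂ)
      = (quarticDensity δ c η y : ℂ) := by
  have hpoint : ∀ ξ : ℝ, w δ 1 (c * ξ) * e (ξ * y) * (Real.exp (-(π * η ^ 2) * ξ ^ 2) : ℂ)
      = ∫ γ in Set.Ioc δ 1, e (ξ * (c * γ ^ 4 + y)) * (Real.exp (-(π * η ^ 2) * ξ ^ 2) : ℂ) := by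
    intro ξ
    rw [w, mul_one, intervalIntegral.integral_of_le hδ, ← integral_mul_const, ← integral_mul_const]
    congr 1
    ext γ
    rw [← e_add]
    ring_nf
  simp only [hpoint]
  rw [integral_integral_swap]
  · simp only [integral_e_mul_gaussian hη]
    rw [integral_complex_ofReal, quarticDensity, intervalIntegral.integral_of_le hδ]
  · have hg : Integrable (fun z : ℝ × ℝ => Real.exp (-(π * η ^ 2) * z.1 ^ 2) * 1)
        (volume.prod (volume.restrict (Set.Ioc δ 1))) :=
      (integrable_gaussian hη).mul_prod (integrable_const (1 : ℝ))
    refine hg.mono' (Continuous.aestronglyMeasurable ?_) (ae_of_all _ fun z => ?_)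
    · refine (continuous_e.comp (by fun_prop)).mul ?_
      fun_prop
    · simp [Function.uncurry, norm_e, -Complex.ofReal_exp]

/-- The part `∑_{3 ≤ j ≤ s} a_j γ_j⁴` of a diagonal quartic form. -/
def quarticTail (s : ℕ) (a : ℕ → ℤ) (γ : Finset.Icc 3 s → ℝ) : ℝ :=
  ∑ i : Finset.Icc 3 s, (a i : ℝ) * γ i ^ 4

lemma continuous_quarticTail (s : ℕ) (a : ℕ → ℤ) : Continuous (quarticTail s a) := by
  unfold quarticTail
  fun_prop

/-- Lebesgue measure on the unit cube of the variables `γ₃, …, γ_s`. -/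
def cubeMeasure (s : ℕ) : Measure (Finset.Icc 3 s → ℝ) :=
  Measure.pi fun _ => volume.restrict (Set.Ioc 0 1)

instance (s : ℕ) : IsFiniteMeasure (cubeMeasure s) := by
  unfold cubeMeasure
  infer_instance

lemma singularIntegrand_eq_integral {s : ℕ} (hs : 2 ≤ s) {a b : ℕ → ℤ} (δ : ℝ) (ha2 : a 2 = 0)
    (p : ℝ × ℝ) :
    singularIntegrand s a b δ p = ∫ γ, (w δ 1 ((a 1 : ℝ) * p.1) * e (p.1 * quarticTail s a γ)) *
      (w 0 1 ((b 2 : ℝ) * p.2) * e (p.2 * quarticTail s b γ)) ∂cubeMeasure s := by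
  have hins : Finset.Icc 2 s = insert 2 (Finset.Icc 3 s) := by
    ext j
    simp only [Finset.mem_Icc, Finset.mem_insert]
    omega
  have hprod : ∏ j ∈ Finset.Icc 3 s, v 1 ((a j : ℝ) * p.1 + (b j : ℝ) * p.2)
      = ∫ γ, e (p.1 * quarticTail s a γ) * e (p.2 * quarticTail s b γ) ∂cubeMeasure s := by
    rw [← Finset.prod_coe_sort]
    simp only [v, intervalIntegral.integral_of_le zero_le_one]
    rw [cubeMeasure, ← integral_fintype_prod_eq_prod]
    congr 1
    ext γ
    rw [← e_add, ← e_sum, quarticTail, quarticTail, Finset.mul_sum, Finset.mul_sum,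
      ← Finset.sum_add_distrib]
    congr 1
    exact Finset.sum_congr rfl fun i _ => by ring
  rw [singularIntegrand, hins, Finset.prod_insert (by simp), hprod, ha2, v_eq_w, ← mul_assoc,
    ← integral_const_mul]
  congr 1
  ext γ
  rw [Int.cast_zero, zero_mul, zero_add]
  ring

/-- Fourier inversion: the Gaussian-damped singular integral is an average of smoothed densities. -/
lemma integral_singularIntegrand_mul_gaussian {s : ℕ} (hs : 2 ≤ s) {a b : ℕ → ℤ} {δ η : ℝ}
    (hδ0 : 0 ≤ δ) (hδ1 : δ ≤ 1) (hη : 0 < η) (ha2 : a 2 = 0) :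
    ∫ p, singularIntegrand s a b δ p * ((Real.exp (-(π * η ^ 2) * p.1 ^ 2) : ℂ) *
        (Real.exp (-(π * η ^ 2) * p.2 ^ 2) : ℂ))
      = ((∫ γ, quarticDensity δ (a 1) η (quarticTail s a γ) *
          quarticDensity 0 (b 2) η (quarticTail s b γ) ∂cubeMeasure s : ℝ) : ℂ) := by
  simp only [singularIntegrand_eq_integral hs δ ha2, ← integral_mul_const]
  have hca := continuous_quarticTail s a
  have hcb := continuous_quarticTail s b
  rw [integral_integral_swap, ← integral_complex_ofReal]
  · congr 1
    ext γ
    rw [Complex.ofReal_mul, ← integral_w_mul_e_mul_gaussian hδ1 hη,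
      ← integral_w_mul_e_mul_gaussian zero_le_one hη, ← integral_prod_mul]
    congr 1
    ext p
    ring
  · have hg : Integrable (fun z : (ℝ × ℝ) × (Finset.Icc 3 s → ℝ) =>
        (Real.exp (-(π * η ^ 2) * z.1.1 ^ 2) * Real.exp (-(π * η ^ 2) * z.1.2 ^ 2)) * 1)
        (volume.prod (cubeMeasure s)) :=
      ((integrable_gaussian hη).mul_prod (integrable_gaussian hη)).mul_prod
        (integrable_const (1 : ℝ))
    refine hg.mono' (Continuous.aestronglyMeasurable ?_) (ae_of_all _ fun z => ?_)
    · refine (((continuous_w δ 1).comp (by fun_prop)).mul (continuous_e.comp (by fun_prop))).mul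
        (((continuous_w 0 1).comp (by fun_prop)).mul (continuous_e.comp (by fun_prop))) |>.mul ?_
      fun_prop
    · have h1 := (norm_w_le_sub hδ1 ((a 1 : ℝ) * z.1.1)).trans (by linarith : 1 - δ ≤ 1)
      have h2 := (norm_w_le_sub zero_le_one ((b 2 : ℝ) * z.1.2)).trans
        (by norm_num : 1 - 0 ≤ (1 : ℝ))
      simp only [Function.uncurry, norm_mul, norm_e, mul_one, Complex.norm_real,
        Real.norm_of_nonneg (Real.exp_pos _).le]
      exact mul_le_of_le_one_left (by positivity) (mul_le_one₀ h1 (norm_nonneg _) h2)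

lemma cubeMeasure_pos_of_mem_nhds {s : ℕ} {θ : Finset.Icc 3 s → ℝ} (hθ : ∀ i, 0 < θ i ∧ θ i < 1)
    {U : Set (Finset.Icc 3 s → ℝ)} (hU : U ∈ nhds θ) : 0 < cubeMeasure s U := by
  have hcube : Set.univ.pi (fun _ : Finset.Icc 3 s => Set.Ioc (0 : ℝ) 1) ∈ nhds θ :=
    set_pi_mem_nhds Set.finite_univ fun i _ => Ioc_mem_nhds (hθ i).1 (hθ i).2
  rw [cubeMeasure, ← Measure.restrict_pi_pi]
  exact (Measure.measure_pos_of_mem_nhds _ (Filter.inter_mem hU hcube)).trans_le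
    (Measure.le_restrict_apply _ _)

lemma tendsto_integral_mul_gaussian {F : ℝ × ℝ → ℂ} (hF : Integrable F) :
    Tendsto (fun η : ℝ => ∫ p, F p * ((Real.exp (-(π * η ^ 2) * p.1 ^ 2) : ℂ) *
        (Real.exp (-(π * η ^ 2) * p.2 ^ 2) : ℂ))) (nhdsWithin 0 (Set.Ioi 0))
      (nhds (∫ p, F p)) := by
  have hexp : ∀ η x : ℝ, Real.exp (-(π * η ^ 2) * x ^ 2) ≤ 1 := fun η x => by
    rw [Real.exp_le_one_iff, neg_mul, neg_nonpos]
    have := Real.pi_pos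
    positivity
  refine tendsto_integral_filter_of_dominated_convergence (fun p => ‖F p‖)
    (Eventually.of_forall fun η => hF.aestronglyMeasurable.mul
      (Continuous.aestronglyMeasurable (by fun_prop)))
    (Eventually.of_forall fun η => ae_of_all _ fun p => ?_) hF.norm (ae_of_all _ fun p => ?_)
  · rw [norm_mul, norm_mul, Complex.norm_real, Complex.norm_real,
      Real.norm_of_nonneg (Real.exp_pos _).le, Real.norm_of_nonneg (Real.exp_pos _).le]
    exact mul_le_of_le_one_right (norm_nonneg _)
      (mul_le_one₀ (hexp _ _) (Real.exp_pos _).le (hexp _ _))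
  · have hc : Continuous fun η : ℝ => F p * ((Real.exp (-(π * η ^ 2) * p.1 ^ 2) : ℂ) *
        (Real.exp (-(π * η ^ 2) * p.2 ^ 2) : ℂ)) := by fun_prop
    have := hc.tendsto 0
    simp only [ne_eq, OfNat.ofNat_ne_zero, not_false_eq_true, zero_pow, mul_zero, neg_zero,
      zero_mul, Real.exp_zero, Complex.ofReal_one, mul_one] at this
    exact this.mono_left nhdsWithin_le_nhds

lemma re_integral_singularIntegrand_pos {s : ℕ} (hs : 2 ≤ s) {a b : ℕ → ℤ} {δ : ℝ}
    (hδ0 : 0 ≤ δ) (ha2 : a 2 = 0) (ha1 : a 1 ≠ 0) (hb2 : b 2 ≠ 0)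
    (hint : Integrable (singularIntegrand s a b δ)) {θ : ℕ → ℝ} (hθδ : δ < θ 1)
    (hθ : ∀ j ∈ Finset.Icc 1 s, 0 < θ j ∧ θ j < 1)
    (hA : quarticTail s a (fun i => θ i) = -(a 1 * θ 1 ^ 4))
    (hB : quarticTail s b (fun i => θ i) = -(b 2 * θ 2 ^ 4)) :
    0 < (∫ p, singularIntegrand s a b δ p).re := by
  have hθ1 := hθ 1 (Finset.mem_Icc.mpr ⟨le_rfl, by omega⟩)
  have hθ2 := hθ 2 (Finset.mem_Icc.mpr ⟨by omega, hs⟩)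
  have hδ1 : δ ≤ 1 := by linarith
  obtain ⟨U, hU, κ, hκ, η₀, hη₀, hlow⟩ := exists_le_quarticDensity (c := a 1)
    (by exact_mod_cast ha1) hδ0 hθδ hθ1.2
  obtain ⟨U', hU', κ', hκ', η₀', hη₀', hlow'⟩ := exists_le_quarticDensity (c := b 2)
    (by exact_mod_cast hb2) le_rfl hθ2.1 hθ2.2
  rw [← hA] at hU
  rw [← hB] at hU'
  set W := quarticTail s a ⁻¹' U ∩ quarticTail s b ⁻¹' U'
  have hW : 0 < (cubeMeasure s).real W := by
    refine ENNReal.toReal_pos (cubeMeasure_pos_of_mem_nhds (θ := fun i => θ i) (fun i => ?_)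
      (Filter.inter_mem ((continuous_quarticTail s a).continuousAt hU)
        ((continuous_quarticTail s b).continuousAt hU'))).ne' (measure_ne_top _ _)
    have := Finset.mem_Icc.mp i.2
    exact hθ i (Finset.mem_Icc.mpr ⟨by omega, this.2⟩)
  refine (show 0 < κ * κ' * (cubeMeasure s).real W by positivity).trans_le ?_
  refine ge_of_tendsto ((Complex.continuous_re.tendsto _).comp (tendsto_integral_mul_gaussian hint))
    (Filter.eventually_of_mem (Ioo_mem_nhdsGT (lt_min hη₀ hη₀')) fun η hη => ?_)
  have hη0 : 0 < η := hη.1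
  rw [Function.comp_apply, integral_singularIntegrand_mul_gaussian hs hδ0 hδ1 hη0 ha2,
    Complex.ofReal_re]
  have hnonneg : ∀ γ, 0 ≤ quarticDensity δ (a 1) η (quarticTail s a γ) *
      quarticDensity 0 (b 2) η (quarticTail s b γ) := fun γ =>
    mul_nonneg (quarticDensity_nonneg hδ1 hη0 _) (quarticDensity_nonneg zero_le_one hη0 _)
  have hintg : Integrable (fun γ => quarticDensity δ (a 1) η (quarticTail s a γ) *
      quarticDensity 0 (b 2) η (quarticTail s b γ)) (cubeMeasure s) := by
    refine Integrable.of_bound (C := η⁻¹ * η⁻¹) (Continuous.aestronglyMeasurable ?_)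
      (ae_of_all _ fun γ => ?_)
    · exact ((continuous_quarticDensity _ _ _).comp (continuous_quarticTail s a)).mul
        ((continuous_quarticDensity _ _ _).comp (continuous_quarticTail s b))
    · rw [Real.norm_of_nonneg (hnonneg γ)]
      exact mul_le_mul (quarticDensity_le hδ0 hδ1 hη0 _)
        (quarticDensity_le le_rfl zero_le_one hη0 _)
        (quarticDensity_nonneg zero_le_one hη0 _) (by positivity)
  refine le_trans ?_ (mul_meas_ge_le_integral_of_nonneg (ae_of_all _ hnonneg) hintg (κ * κ'))
  refine mul_le_mul_of_nonneg_left (measureReal_mono fun γ hγ => ?_) (by positivity)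
  exact mul_le_mul (hlow _ hγ.1 η hη0 (hη.2.trans_le (min_le_left _ _)))
    (hlow' _ hγ.2 η hη0 (hη.2.trans_le (min_le_right _ _))) hκ'.le
    (quarticDensity_nonneg hδ1 hη0 _)

open scoped Classical in
/-- the singular integral `𝔍 = lim_X 𝔍(X)` converges for each `P ≥ 2`, with
`|𝔍 − 𝔍(X)| ≪ P^{s−8}X⁻¹` uniformly in `P` and `X ≥ 1`; and if the system has a
non-singular real solution `θ ∈ (0,1)^s` with `θ₁ > δ`, then `𝔍 ≫ P^{s−8}`. -/
theorem singular_integral_convergence_positivity (s : ℕ) (hs : 22 ≤ s) (a b : ℕ → ℤ)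
    (δ : ℝ) (hδ0 : 0 < δ) (hδ1 : δ < 1)
    (hnz : ∀ j ∈ Finset.Icc 1 s, (a j, b j) ≠ (0, 0))
    (ha2 : a 2 = 0) (hb1 : b 1 = 0) (hab : a 1 * b 2 ≠ 0)
    (hmult : ∀ j ∈ Finset.Icc 2 22, ((Finset.Icc 2 22).filter
        (fun i => equivForm (a i) (b i) (a j) (b j))).card ≤ 7) :
    ∃ (𝔍 : ℝ → ℂ) (C : ℝ),
      (∀ P : ℝ, 2 ≤ P →
        Filter.Tendsto (fun X : ℝ => 𝔍X s a b δ P X) Filter.atTop (nhds (𝔍 P)) ∧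
        ∀ X : ℝ, 1 ≤ X → ‖𝔍 P - 𝔍X s a b δ P X‖ ≤ C * P ^ (s - 8) / X) ∧
      ((∃ θ : ℕ → ℝ, (∀ j ∈ Finset.Icc 1 s, 0 < θ j ∧ θ j < 1) ∧ δ < θ 1 ∧
          (∑ j ∈ Finset.Icc 1 s, (a j : ℝ) * θ j ^ 4 = 0) ∧
          (∑ j ∈ Finset.Icc 1 s, (b j : ℝ) * θ j ^ 4 = 0) ∧
          ∃ i ∈ Finset.Icc 1 s, ∃ j ∈ Finset.Icc 1 s,
            (a i : ℝ) * θ i ^ 3 * ((b j : ℝ) * θ j ^ 3)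
              - (a j : ℝ) * θ j ^ 3 * ((b i : ℝ) * θ i ^ 3) ≠ 0) →
        ∃ c : ℝ, 0 < c ∧ ∀ P : ℝ, 2 ≤ P → c * P ^ (s - 8) ≤ (𝔍 P).re) := by
  have hsub : Finset.Icc 2 22 ⊆ Finset.Icc 1 s := Finset.Icc_subset_Icc (by norm_num) hs
  obtain ⟨C, hC0, hC⟩ := exists_norm_singularIntegrand_le hs hδ0.le hδ1.le
    (fun j hj => hnz j (hsub hj)) hmult
  have hcont := continuous_singularIntegrand s a b δ
  have hint := integrable_of_norm_le_one_add_norm hcont hC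
  obtain ⟨D, hD⟩ := exists_norm_integral_sub_setIntegral_square_le hcont hC0 hC
  have hbound : ∀ P : ℝ, 2 ≤ P → ∀ X : ℝ, 0 < X →
      ‖(P : ℂ) ^ (s - 8) * (∫ p, singularIntegrand s a b δ p) - 𝔍X s a b δ P X‖
        ≤ D * P ^ (s - 8) / X := by
    intro P hP X hX
    have hP0 : 0 < P := by linarith
    rw [𝔍X_scale (by omega) a b δ hP0, 𝔍X_one_eq_setIntegral hint hX.le, ← mul_sub, norm_mul,
      norm_pow, Complex.norm_real, Real.norm_of_nonneg hP0.le]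
    calc P ^ (s - 8) * _ ≤ P ^ (s - 8) * (D / X) := by gcongr; exact hD X hX
      _ = D * P ^ (s - 8) / X := by ring
  refine ⟨fun P => (P : ℂ) ^ (s - 8) * ∫ p, singularIntegrand s a b δ p, D, fun P hP => ⟨?_,
    fun X hX => hbound P hP X (by linarith)⟩, ?_⟩
  · rw [tendsto_iff_norm_sub_tendsto_zero]
    refine squeeze_zero' (Eventually.of_forall fun _ => norm_nonneg _)
      ((eventually_gt_atTop 0).mono fun X hX => ?_)
      (tendsto_const_nhds.div_atTop tendsto_id : Tendsto (fun X => D * P ^ (s - 8) / X) _ _)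
    rw [norm_sub_rev]
    exact hbound P hP X hX
  · rintro ⟨θ, hθ, hθδ, hA, hB, -⟩
    have hins : Finset.Icc 1 s = insert 1 (insert 2 (Finset.Icc 3 s)) := by
      ext j
      simp only [Finset.mem_Icc, Finset.mem_insert]
      omega
    have htail : ∀ c : ℕ → ℤ, quarticTail s c (fun i => θ i)
        = ∑ j ∈ Finset.Icc 3 s, (c j : ℝ) * θ j ^ 4 := fun c =>
      Finset.sum_coe_sort (Finset.Icc 3 s) fun j => (c j : ℝ) * θ j ^ 4
    rw [hins, Finset.sum_insert (by simp), Finset.sum_insert (by simp), ← htail] at hA hB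
    rw [ha2, Int.cast_zero] at hA
    rw [hb1, Int.cast_zero] at hB
    refine ⟨(∫ p, singularIntegrand s a b δ p).re,
      re_integral_singularIntegrand_pos (by omega) hδ0.le ha2 (left_ne_zero_of_mul hab)
        (right_ne_zero_of_mul hab) hint hθδ hθ (by linarith) (by linarith), fun P _ => ?_⟩
    simp only [← Complex.ofReal_pow, Complex.re_ofReal_mul, mul_comm, le_refl]
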